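/- Let n ≥ 1, let M be a real n×n matrix, and suppose there is an invertible real n×n matrix V such that V^{−1} M V is diagonal with all diagonal entries positive. If u : ℝ → ℝⁿ is twice differentiable with u''(t) = −M u(t) for all t, u(0) = u₀, and u'(0) = 0, then ‖u(t)‖ ≤ cond(V) · ‖u₀‖ for all t ≥ 0. -/

import Mathlib

/-- A solution of the harmonic oscillator equation `ÿ = -cy`, `c > 0`, released at rest never
exceeds its initial amplitude. -/
theorem sq_le_sq_of_harmonic_oscillator {c : ℝ} (hc : 0 < c) {y y' : ℝ → ℝ}
    (hy : ∀ t, HasDerivAt y (y' t) t) (hy' : ∀ t, HasDerivAt y' (-(c * y t)) t)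
    (h0 : y' 0 = 0) (t : ℝ) : y t ^ 2 ≤ y 0 ^ 2 := by
  have energy_deriv : ∀ s, HasDerivAt (fun s => y' s ^ 2 + c * y s ^ 2) 0 s := by
    intro s
    refine (((hy' s).fun_pow 2).fun_add (((hy s).fun_pow 2).const_mul c)).congr_deriv ?_
    norm_num
    ring
  have energy_eq := is_const_of_deriv_eq_zero (fun s => (energy_deriv s).differentiableAt)
    (fun s => (energy_deriv s).deriv) t 0
  simp only [h0] at energy_eq
  refine le_of_mul_le_mul_left ?_ hc
  nlinarith [sq_nonneg (y' t)]

/-- dynamical stability bound.  If `V⁻¹ M V` is diagonal with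
positive diagonal entries, then every solution of `ü = -Mu`, `u(0) = u₀`,
`u̇(0) = 0` satisfies `‖u(t)‖ ≤ cond(V) ‖u₀‖` for all `t ≥ 0`, where
`cond(V) = ‖V‖‖V⁻¹‖` is the condition number with respect to the Euclidean
operator norm. -/
theorem dynamical_stability (n : ℕ) (hn : 1 ≤ n)
    (M V : Matrix (Fin n) (Fin n) ℝ) (hV : IsUnit V)
    (d : Fin n → ℝ) (hd : ∀ i, 0 < d i)
    (hdiag : V⁻¹ * M * V = Matrix.diagonal d)
    (u u' u'' : ℝ → EuclideanSpace ℝ (Fin n))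
    (hu' : ∀ t, HasDerivAt u (u' t) t)
    (hu'' : ∀ t, HasDerivAt u' (u'' t) t)
    (hode : ∀ t i, u'' t i = -(M.mulVec (fun j => u t j)) i)
    (u₀ : EuclideanSpace ℝ (Fin n)) (h0 : u 0 = u₀) (h0' : u' 0 = 0) :
    ∀ t : ℝ, 0 ≤ t →
      ‖u t‖ ≤ (‖Matrix.toEuclideanCLM (𝕜 := ℝ) V‖ *
        ‖Matrix.toEuclideanCLM (𝕜 := ℝ) V⁻¹‖) * ‖u₀‖ := by
  intro t _
  set A := Matrix.toEuclideanCLM (𝕜 := ℝ) V with hA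
  set W := Matrix.toEuclideanCLM (𝕜 := ℝ) V⁻¹ with hW
  have hdet : IsUnit V.det := (Matrix.isUnit_iff_isUnit_det V).mp hV
  have hAW : A * W = 1 := by
    rw [hA, hW, ← map_mul, Matrix.mul_nonsing_inv V hdet, map_one]
  have hinter : W * Matrix.toEuclideanCLM (𝕜 := ℝ) M =
      Matrix.toEuclideanCLM (𝕜 := ℝ) (Matrix.diagonal d) * W := by
    rw [hW, ← map_mul, ← map_mul, ← hdiag, Matrix.mul_assoc (V⁻¹ * M),
      Matrix.mul_nonsing_inv V hdet, Matrix.mul_one]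
  have hacc : ∀ s, u'' s = -(Matrix.toEuclideanCLM (𝕜 := ℝ) M (u s)) := by
    intro s
    ext i
    rw [hode s i]
    rfl
  have hmode : ∀ s i, W (u'' s) i = -(d i * W (u s) i) := by
    intro s i
    have h := congrArg (fun T => T (u s) i) hinter
    simp only [mul_apply_eq_comp, Matrix.ofLp_toEuclideanCLM,
      Matrix.mulVec_diagonal] at h
    rw [hacc, map_neg, PiLp.neg_apply, h]
  have hderiv : ∀ {f : ℝ → EuclideanSpace ℝ (Fin n)} {f' : EuclideanSpace ℝ (Fin n)} {s : ℝ},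
      HasDerivAt f f' s → ∀ i, HasDerivAt (fun r => W (f r) i) (W f' i) s := fun hf i =>
    ((EuclideanSpace.proj (𝕜 := ℝ) i).comp W).hasFDerivAt.comp_hasDerivAt _ hf
  have hW_le : ‖W (u t)‖ ≤ ‖W u₀‖ := by
    rw [EuclideanSpace.norm_eq, EuclideanSpace.norm_eq]
    refine Real.sqrt_le_sqrt (Finset.sum_le_sum fun i _ => ?_)
    rw [Real.norm_eq_abs, Real.norm_eq_abs, sq_abs, sq_abs, ← h0]
    exact sq_le_sq_of_harmonic_oscillator (hd i) (fun s => hderiv (hu' s) i)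
      (fun s => hmode s i ▸ hderiv (hu'' s) i) (by simp [h0']) t
  calc ‖u t‖ = ‖A (W (u t))‖ := by
        rw [← mul_apply_eq_comp, hAW, one_apply_eq_self]
    _ ≤ ‖A‖ * ‖W (u t)‖ := A.le_opNorm _
    _ ≤ ‖A‖ * (‖W‖ * ‖u₀‖) := by
        gcongr
        exact hW_le.trans (W.le_opNorm _)
    _ = ‖A‖ * ‖W‖ * ‖u₀‖ := by ring
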